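/- Let a, b, c > 0 with a+b ≥ c. Then the generalized modulus μ_{a,b,c} is a strictly decreasing homeomorphism of (0,1) onto (0,∞). -/

import Mathlib

open Filter Set

/-- Shifted factorial (Appell symbol) `(a,n) = a(a+1)⋯(a+n−1)`, with `(a,0)=1`. -/
noncomputable def shiftedFact (a : ℝ) (n : ℕ) : ℝ := ∏ i ∈ Finset.range n, (a + i)

/-- Gaussian hypergeometric function `F(a,b;c;x)` as a real power series. -/
noncomputable def hypF (a b c x : ℝ) : ℝ :=
  ∑' n : ℕ, (shiftedFact a n * shiftedFact b n / (shiftedFact c n * (n.factorial : ℝ))) * x ^ n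

/-- Beta function `B(x,y) = Γ(x)Γ(y)/Γ(x+y)`. -/
noncomputable def betaR (x y : ℝ) : ℝ := Real.Gamma x * Real.Gamma y / Real.Gamma (x + y)

/-- Generalized modulus `μ_{a,b,c}(r)`. -/
noncomputable def muG (a b c r : ℝ) : ℝ :=
  betaR a b / 2 * hypF a b c (1 - r ^ 2) / hypF a b c (r ^ 2)

/-- The coefficient of `x ^ n` in the power series of `F(a,b;c;x)`. -/
noncomputable def hypCoeff (a b c : ℝ) (n : ℕ) : ℝ :=
  shiftedFact a n * shiftedFact b n / (shiftedFact c n * (n.factorial : ℝ))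

lemma shiftedFact_pos {a : ℝ} (ha : 0 < a) (n : ℕ) : 0 < shiftedFact a n :=
  Finset.prod_pos fun _ _ => by positivity

lemma shiftedFact_succ (a : ℝ) (n : ℕ) : shiftedFact a (n + 1) = shiftedFact a n * (a + n) :=
  Finset.prod_range_succ _ _

section

variable {a b c : ℝ}

lemma hypF_eq_tsum (a b c x : ℝ) : hypF a b c x = ∑' n, hypCoeff a b c n * x ^ n := rfl

lemma hypCoeff_zero (a b c : ℝ) : hypCoeff a b c 0 = 1 := by
  simp [hypCoeff, shiftedFact]

lemma hypCoeff_one (a b c : ℝ) : hypCoeff a b c 1 = a * b / c := by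
  simp [hypCoeff, shiftedFact]

lemma hypCoeff_pos (ha : 0 < a) (hb : 0 < b) (hc : 0 < c) (n : ℕ) : 0 < hypCoeff a b c n := by
  have h₁ := shiftedFact_pos ha n
  have h₂ := shiftedFact_pos hb n
  have h₃ := shiftedFact_pos hc n
  unfold hypCoeff
  positivity

lemma hypCoeff_succ (hc : 0 < c) (n : ℕ) :
    hypCoeff a b c (n + 1) = hypCoeff a b c n * ((a + n) * (b + n) / ((c + n) * (n + 1))) := by
  have h₃ := shiftedFact_pos hc n
  have h₄ : 0 < c + n := by positivity
  have h₅ : (0 : ℝ) < n.factorial := by positivity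
  simp only [hypCoeff, shiftedFact_succ, Nat.factorial_succ]
  push_cast
  field_simp

lemma tendsto_hypCoeff_ratio (a b c : ℝ) :
    Tendsto (fun n : ℕ => (a + n) * (b + n) / ((c + n) * (n + 1))) atTop (nhds 1) := by
  have h (y : ℝ) : Tendsto (fun n : ℕ => (y + n) / (n : ℝ)) atTop (nhds 1) := by
    have h₀ : Tendsto (fun n : ℕ => y / (n : ℝ) + 1) atTop (nhds (0 + 1)) :=
      (tendsto_const_div_atTop_nhds_zero_nat y).add tendsto_const_nhds
    rw [zero_add] at h₀
    refine h₀.congr' ?_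
    filter_upwards [eventually_gt_atTop 0] with n hn
    field_simp
  have h' := ((h a).mul (h b)).div ((h c).mul (h 1)) (by norm_num)
  norm_num at h'
  refine h'.congr' ?_
  filter_upwards [eventually_gt_atTop 0] with n hn
  have : (0 : ℝ) < n := by exact_mod_cast hn
  simp only [Pi.div_apply]
  rw [div_mul_div_comm, div_mul_div_comm, div_div_div_cancel_right₀ (by positivity),
    add_comm (1 : ℝ)]

lemma summable_hypCoeff_mul_pow (ha : 0 < a) (hb : 0 < b) (hc : 0 < c) {x : ℝ} (hx₀ : 0 ≤ x)
    (hx₁ : x < 1) : Summable fun n => hypCoeff a b c n * x ^ n := by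
  rcases hx₀.eq_or_lt with rfl | hx
  · exact summable_of_ne_finset_zero (s := {0}) fun n hn => by simp_all
  refine summable_of_ratio_test_tendsto_lt_one hx₁
    (Eventually.of_forall fun n => (mul_pos (hypCoeff_pos ha hb hc n) (pow_pos hx n)).ne') ?_
  have h := (tendsto_hypCoeff_ratio a b c).mul_const x
  rw [one_mul] at h
  refine h.congr fun n => ?_
  have hp := hypCoeff_pos ha hb hc n
  have hp' := hypCoeff_pos ha hb hc (n + 1)
  rw [Real.norm_of_nonneg (by positivity), Real.norm_of_nonneg (by positivity),
    eq_div_iff (by positivity), hypCoeff_succ hc, pow_succ]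
  ring

lemma strictMonoOn_hypF (ha : 0 < a) (hb : 0 < b) (hc : 0 < c) :
    StrictMonoOn (hypF a b c) (Ico 0 1) := by
  intro x hx y hy hxy
  rw [hypF_eq_tsum, hypF_eq_tsum]
  refine Summable.tsum_lt_tsum (i := 1) (fun n => ?_) ?_
    (summable_hypCoeff_mul_pow ha hb hc hx.1 hx.2) (summable_hypCoeff_mul_pow ha hb hc hy.1 hy.2)
  · exact mul_le_mul_of_nonneg_left (pow_le_pow_left₀ hx.1 hxy.le n) (hypCoeff_pos ha hb hc n).le
  · simpa using mul_lt_mul_of_pos_left hxy (hypCoeff_pos ha hb hc 1)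

lemma hypF_zero (a b c : ℝ) : hypF a b c 0 = 1 := by
  rw [hypF_eq_tsum, tsum_eq_single 0 fun n hn => by simp [hn]]
  simp [hypCoeff_zero]

lemma hypF_pos (ha : 0 < a) (hb : 0 < b) (hc : 0 < c) {x : ℝ} (hx : x ∈ Ico (0 : ℝ) 1) :
    0 < hypF a b c x := by
  have h := (strictMonoOn_hypF ha hb hc).monotoneOn (left_mem_Ico.2 zero_lt_one) hx hx.1
  rw [hypF_zero] at h
  linarith

lemma continuousOn_hypF (ha : 0 < a) (hb : 0 < b) (hc : 0 < c) :
    ContinuousOn (hypF a b c) (Ioo (-1) 1) := by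
  intro x hx
  obtain ⟨r, hxr, hr⟩ := exists_between (abs_lt.2 ⟨hx.1, hx.2⟩)
  have hr₀ : 0 ≤ r := (abs_nonneg x).trans hxr.le
  have h : ContinuousOn (hypF a b c) (Icc (-r) r) := by
    refine continuousOn_tsum (fun n => by fun_prop)
      (summable_hypCoeff_mul_pow ha hb hc hr₀ hr) fun n y hy => ?_
    change ‖hypCoeff a b c n * y ^ n‖ ≤ _
    rw [norm_mul, norm_pow, Real.norm_of_nonneg (hypCoeff_pos ha hb hc n).le]
    exact mul_le_mul_of_nonneg_left (pow_le_pow_left₀ (norm_nonneg y) (abs_le.2 hy) n)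
      (hypCoeff_pos ha hb hc n).le
  have hx' := abs_lt.1 hxr
  exact (h.continuousAt (Icc_mem_nhds hx'.1 hx'.2)).continuousWithinAt

lemma le_hypCoeff_succ (ha : 0 < a) (hb : 0 < b) (hc : 0 < c) (habc : c ≤ a + b) (n : ℕ) :
    a * b / c * (1 / ((n : ℝ) + 1)) ≤ hypCoeff a b c (n + 1) := by
  rw [mul_one_div, div_le_iff₀ (by positivity)]
  induction n with
  | zero => simp [hypCoeff_one]
  | succ n ih =>
    refine ih.trans ?_
    have hp := hypCoeff_pos ha hb hc (n + 1)
    rw [hypCoeff_succ hc (n + 1), mul_assoc]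
    refine mul_le_mul_of_nonneg_left ?_ hp.le
    push_cast
    rw [div_mul_eq_mul_div, le_div_iff₀ (by positivity)]
    have : 0 ≤ (a * b + (a + b - c) * ((n : ℝ) + 1)) * (n + 2) := by
      have := sub_nonneg.2 habc
      positivity
    nlinarith

lemma neg_log_le_hypF (ha : 0 < a) (hb : 0 < b) (hc : 0 < c) (habc : c ≤ a + b) {x : ℝ}
    (hx₀ : 0 ≤ x) (hx₁ : x < 1) : a * b / c * -Real.log (1 - x) ≤ hypF a b c x := by
  have hs := summable_hypCoeff_mul_pow ha hb hc hx₀ hx₁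
  have hl := (Real.hasSum_pow_div_log_of_abs_lt_one (abs_lt.2 ⟨by linarith, hx₁⟩)).mul_left
    (a * b / c)
  have h := hl.summable.tsum_le_tsum (fun n => ?_) ((summable_nat_add_iff 1).2 hs)
  · rw [hl.tsum_eq] at h
    rw [hypF_eq_tsum, hs.tsum_eq_zero_add, hypCoeff_zero]
    linarith [pow_zero x]
  · have := mul_le_mul_of_nonneg_right (le_hypCoeff_succ ha hb hc habc n)
      (pow_nonneg hx₀ (n + 1))
    refine le_of_eq_of_le ?_ this
    ring

lemma tendsto_hypF_atTop (ha : 0 < a) (hb : 0 < b) (hc : 0 < c) (habc : c ≤ a + b) :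
    Tendsto (hypF a b c) (nhdsWithin 1 (Iio 1)) atTop := by
  have h₁ : Tendsto (fun x : ℝ => 1 - x) (nhdsWithin 1 (Iio 1)) (nhdsWithin 0 (Ioi 0)) := by
    refine tendsto_nhdsWithin_iff.2 ⟨?_, ?_⟩
    · exact ((by fun_prop : Continuous fun x : ℝ => 1 - x).tendsto' 1 0 (by norm_num)).mono_left
        nhdsWithin_le_nhds
    · filter_upwards [self_mem_nhdsWithin] with x hx
      exact sub_pos.2 (mem_Iio.1 hx)
  have h₂ := tendsto_neg_atBot_atTop.comp (Real.tendsto_log_nhdsGT_zero.comp h₁)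
  refine tendsto_atTop_mono' _ ?_ (h₂.const_mul_atTop (by positivity : 0 < a * b / c))
  filter_upwards [Ioo_mem_nhdsLT (zero_lt_one (α := ℝ))] with x hx
  exact neg_log_le_hypF ha hb hc habc hx.1.le hx.2

lemma tendsto_hypF_zero (ha : 0 < a) (hb : 0 < b) (hc : 0 < c) :
    Tendsto (hypF a b c) (nhds 0) (nhds 1) := by
  have h := (continuousOn_hypF ha hb hc).continuousAt
    (Ioo_mem_nhds (by norm_num) one_pos : Ioo (-1 : ℝ) 1 ∈ nhds 0)
  simpa only [ContinuousAt, hypF_zero] using h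

lemma betaR_pos {x y : ℝ} (hx : 0 < x) (hy : 0 < y) : 0 < betaR x y :=
  div_pos (mul_pos (Real.Gamma_pos_of_pos hx) (Real.Gamma_pos_of_pos hy))
    (Real.Gamma_pos_of_pos (add_pos hx hy))

lemma sq_mem_Ioo {r : ℝ} (hr : r ∈ Ioo (0 : ℝ) 1) : r ^ 2 ∈ Ioo (0 : ℝ) 1 :=
  ⟨pow_pos hr.1 2, pow_lt_one₀ hr.1.le hr.2 two_ne_zero⟩

lemma one_sub_sq_mem_Ioo {r : ℝ} (hr : r ∈ Ioo (0 : ℝ) 1) : 1 - r ^ 2 ∈ Ioo (0 : ℝ) 1 :=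
  ⟨sub_pos.2 (sq_mem_Ioo hr).2, sub_lt_self 1 (sq_mem_Ioo hr).1⟩

lemma muG_pos (ha : 0 < a) (hb : 0 < b) (hc : 0 < c) {r : ℝ} (hr : r ∈ Ioo (0 : ℝ) 1) :
    0 < muG a b c r :=
  div_pos (mul_pos (half_pos (betaR_pos ha hb))
    (hypF_pos ha hb hc (Ioo_subset_Ico_self (one_sub_sq_mem_Ioo hr))))
    (hypF_pos ha hb hc (Ioo_subset_Ico_self (sq_mem_Ioo hr)))

lemma strictAntiOn_muG (ha : 0 < a) (hb : 0 < b) (hc : 0 < c) :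
    StrictAntiOn (muG a b c) (Ioo 0 1) := by
  intro r hr s hs hrs
  have h : r ^ 2 < s ^ 2 := pow_lt_pow_left₀ hrs hr.1.le two_ne_zero
  have hr₁ := Ioo_subset_Ico_self (sq_mem_Ioo hr)
  have hr₂ := Ioo_subset_Ico_self (one_sub_sq_mem_Ioo hr)
  have hs₁ := Ioo_subset_Ico_self (sq_mem_Ioo hs)
  have hs₂ := Ioo_subset_Ico_self (one_sub_sq_mem_Ioo hs)
  have hB := half_pos (betaR_pos ha hb)
  exact div_lt_div₀
    (mul_lt_mul_of_pos_left (strictMonoOn_hypF ha hb hc hs₂ hr₂ (by linarith)) hB)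
    (strictMonoOn_hypF ha hb hc hr₁ hs₁ h).le
    (mul_pos hB (hypF_pos ha hb hc hr₂)).le (hypF_pos ha hb hc hr₁)

lemma continuousOn_muG (ha : 0 < a) (hb : 0 < b) (hc : 0 < c) :
    ContinuousOn (muG a b c) (Ioo 0 1) := by
  have hF := (continuousOn_hypF ha hb hc).mono (Ioo_subset_Ioo_left (by norm_num : (-1 : ℝ) ≤ 0))
  exact (continuousOn_const.mul
    (hF.comp (by fun_prop) fun _ hr => one_sub_sq_mem_Ioo hr)).div
    (hF.comp (by fun_prop) fun _ hr => sq_mem_Ioo hr)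
    fun _ hr => (hypF_pos ha hb hc (Ioo_subset_Ico_self (sq_mem_Ioo hr))).ne'

lemma tendsto_muG_one (ha : 0 < a) (hb : 0 < b) (hc : 0 < c) (habc : c ≤ a + b) :
    Tendsto (muG a b c) (nhdsWithin 1 (Iio 1)) (nhds 0) := by
  have h₁ : Tendsto (fun r : ℝ => r ^ 2) (nhdsWithin 1 (Iio 1)) (nhdsWithin 1 (Iio 1)) := by
    refine tendsto_nhdsWithin_iff.2 ⟨?_, ?_⟩
    · exact ((continuous_pow 2).tendsto' (1 : ℝ) 1 (by norm_num)).mono_left nhdsWithin_le_nhds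
    · filter_upwards [Ioo_mem_nhdsLT (zero_lt_one (α := ℝ))] with r hr
      exact (sq_mem_Ioo hr).2
  have h₂ : Tendsto (fun r : ℝ => 1 - r ^ 2) (nhdsWithin 1 (Iio 1)) (nhds 0) :=
    ((by fun_prop : Continuous fun r : ℝ => 1 - r ^ 2).tendsto' 1 0 (by norm_num)).mono_left
      nhdsWithin_le_nhds
  exact (((tendsto_hypF_zero ha hb hc).comp h₂).const_mul _).div_atTop
    ((tendsto_hypF_atTop ha hb hc habc).comp h₁)

lemma tendsto_muG_zero (ha : 0 < a) (hb : 0 < b) (hc : 0 < c) (habc : c ≤ a + b) :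
    Tendsto (muG a b c) (nhdsWithin 0 (Ioi 0)) atTop := by
  have h₁ : Tendsto (fun r : ℝ => 1 - r ^ 2) (nhdsWithin 0 (Ioi 0)) (nhdsWithin 1 (Iio 1)) := by
    refine tendsto_nhdsWithin_iff.2 ⟨?_, ?_⟩
    · exact ((by fun_prop : Continuous fun r : ℝ => 1 - r ^ 2).tendsto' 0 1
        (by norm_num)).mono_left nhdsWithin_le_nhds
    · filter_upwards [Ioo_mem_nhdsGT (zero_lt_one (α := ℝ))] with r hr
      exact (one_sub_sq_mem_Ioo hr).2
  have h₂ : Tendsto (fun r : ℝ => r ^ 2) (nhdsWithin 0 (Ioi 0)) (nhds 0) :=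
    ((continuous_pow 2).tendsto' (0 : ℝ) 0 (by norm_num)).mono_left nhdsWithin_le_nhds
  exact (((tendsto_hypF_atTop ha hb hc habc).comp h₁).const_mul_atTop
    (half_pos (betaR_pos ha hb))).atTop_mul_pos one_pos
    (by simpa using ((tendsto_hypF_zero ha hb hc).comp h₂).inv₀ one_ne_zero)

end

theorem stmt10 (a b c : ℝ) (ha : 0 < a) (hb : 0 < b) (hc : 0 < c) (habc : c ≤ a + b) :
    StrictAntiOn (muG a b c) (Set.Ioo 0 1) ∧
    ContinuousOn (muG a b c) (Set.Ioo 0 1) ∧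
    Set.BijOn (muG a b c) (Set.Ioo 0 1) (Set.Ioi 0) := by
  have hanti := strictAntiOn_muG ha hb hc
  have hcont := continuousOn_muG ha hb hc
  refine ⟨hanti, hcont, fun r hr => muG_pos ha hb hc hr, hanti.injOn, ?_⟩
  exact isPreconnected_Ioo.intermediate_value_Ioi
    (le_principal_iff.2 (Ioo_mem_nhdsLT zero_lt_one))
    (le_principal_iff.2 (Ioo_mem_nhdsGT zero_lt_one)) hcont
    (tendsto_muG_one ha hb hc habc) (tendsto_muG_zero ha hb hc habc)
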